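/- A birth-death process X is asymptotically aperiodic if and only if Σ_{j=0}^∞ (1/(p_j π_j)) Σ_{k=0}^j r_k π_k = ∞. -/

import Mathlib

open MeasureTheory Filter Set ProbabilityTheory

/-- A discrete-time Markov chain on a state space `S`: a stochastic transition
matrix `P`, an initial distribution `init`, and the induced probability measure
`μ` on the path space `ℕ → S`, determined by its values on cylinder sets. -/
structure MarkovChain (S : Type) [MeasurableSpace S] where
  P : S → S → ℝ
  P_nonneg : ∀ i j, 0 ≤ P i j
  P_stochastic : ∀ i, HasSum (P i) 1
  init : S → ℝ
  init_nonneg : ∀ i, 0 ≤ init i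
  init_hasSum : HasSum init 1
  μ : Measure (ℕ → S)
  μ_prob : IsProbabilityMeasure μ
  μ_cylinder : ∀ (n : ℕ) (s : ℕ → S),
    μ {ω | ∀ k ≤ n, ω k = s k}
      = ENNReal.ofReal (init (s 0) * ∏ k ∈ Finset.range n, P (s k) (s (k + 1)))

namespace MarkovChain

variable {S : Type} [MeasurableSpace S]

open Classical in
/-- The `n`-step transition probabilities `P^n(i,j)`. -/
noncomputable def Pn (X : MarkovChain S) : ℕ → S → S → ℝ
  | 0, i, j => if i = j then 1 else 0
  | n + 1, i, j => ∑' k : S, X.Pn n i k * X.P k j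

/-- Irreducibility: every state can be reached from every state. -/
def Irreducible (X : MarkovChain S) : Prop := ∀ i j : S, ∃ n : ℕ, 0 < X.Pn n i j

/-- Aperiodicity: for each state, the gcd of the set `{n ≥ 1 | P^n(i,i) > 0}`
is `1` (expressed via common divisors). -/
def Aperiodic (X : MarkovChain S) : Prop :=
  ∀ i : S, ∀ d : ℕ, (∀ n : ℕ, 0 < n → 0 < X.Pn n i i → d ∣ n) → d = 1

/-- `U^(m)(C)`: the event that the `m`-step chain visits `C` infinitely often. -/
def U (X : MarkovChain S) (m : ℕ) (C : Set S) : Set (ℕ → S) :=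
  {ω | ∀ n : ℕ, ∃ k : ℕ, n ≤ k ∧ ω (k * m) ∈ C}

/-- `L^(m)(C)`: the event that the `m`-step chain is eventually in `C`. -/
def L (X : MarkovChain S) (m : ℕ) (C : Set S) : Set (ℕ → S) :=
  {ω | ∃ n : ℕ, ∀ k : ℕ, n ≤ k → ω (k * m) ∈ C}

/-- `C` is transient with respect to the `m`-step chain `X^(m)`. -/
def Transient (X : MarkovChain S) (m : ℕ) (C : Set S) : Prop := X.μ (X.U m C) = 0

/-- `C` is regular with respect to `X^(m)`: `U^(m)(C)` and `L^(m)(C)` agree up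
to a null event. -/
def Regular (X : MarkovChain S) (m : ℕ) (C : Set S) : Prop :=
  X.μ (symmDiff (X.U m C) (X.L m C)) = 0

/-- `C` is almost closed with respect to `X^(m)`: regular but not transient. -/
def AlmostClosed (X : MarkovChain S) (m : ℕ) (C : Set S) : Prop :=
  X.Regular m C ∧ ¬ X.Transient m C

/-- An almost closed set is atomic if it does not contain two disjoint almost
closed subsets. -/
def Atomic (X : MarkovChain S) (m : ℕ) (C : Set S) : Prop :=
  X.AlmostClosed m C ∧
    ¬ ∃ A B : Set S, A ⊆ C ∧ B ⊆ C ∧ Disjoint A B ∧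
      X.AlmostClosed m A ∧ X.AlmostClosed m B

/-- A Blackwell decomposition for the `m`-step chain `X^(m)`: a countable
collection of pairwise disjoint almost closed sets, all atomic except at most
one, where a nonatomic member contains no atomic subsets and consists of
transient states, and such that the probabilities `μ(L^(m)(C))` sum to one. -/
structure IsBlackwell (X : MarkovChain S) (m : ℕ) (𝒞 : Set (Set S)) : Prop where
  countable : 𝒞.Countable
  almostClosed : ∀ C ∈ 𝒞, X.AlmostClosed m C
  disjoint : 𝒞.PairwiseDisjoint id
  atMostOneNonatomic : ∀ C₁ ∈ 𝒞, ∀ C₂ ∈ 𝒞, ¬ X.Atomic m C₁ → ¬ X.Atomic m C₂ → C₁ = C₂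
  nonatomicNoAtomicSubset : ∀ C ∈ 𝒞, ¬ X.Atomic m C → ∀ A : Set S, A ⊆ C → ¬ X.Atomic m A
  nonatomicTransientStates : ∀ C ∈ 𝒞, ¬ X.Atomic m C → ∀ i ∈ C, X.Transient m {i}
  sum_L_eq_one : ∑' C : 𝒞, X.μ (X.L m (C : Set S)) = 1

/-- `β(X^(m))`: the number of sets in a Blackwell decomposition for `X^(m)`
(well defined since the decomposition is unique up to equivalence). -/
noncomputable def beta (X : MarkovChain S) (m : ℕ) : ℕ∞ :=
  sInf (Set.encard '' {𝒞 : Set (Set S) | X.IsBlackwell m 𝒞})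

/-- `X` is simple if `β(X) = 1`. -/
def Simple (X : MarkovChain S) : Prop := X.beta 1 = 1

/-- The asymptotic period `d(X) = sup {m ≥ 1 | β(X^(m)) = m}` (possibly `∞`). -/
noncomputable def period (X : MarkovChain S) : ℕ∞ :=
  sSup {d : ℕ∞ | ∃ m : ℕ, 1 ≤ m ∧ X.beta m = (m : ℕ∞) ∧ d = (m : ℕ∞)}

/-- Recurrence: every state is visited infinitely often almost surely. -/
def Recurrent (X : MarkovChain S) : Prop := ∀ i : S, X.μ (X.U 1 {i}) = 1

end MarkovChain

/-- The shift operator `θ` on path space: `(θ ω)(n) = ω(n+1)`. -/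
def pathShift {S : Type} : (ℕ → S) → ℕ → S := fun ω n => ω (n + 1)

/-- An event `E` is `m`-invariant if its indicator function `f` satisfies
`f(ω) = f(θ^m ω)` for all paths `ω`. -/
def MInvariant {S : Type} (m : ℕ) (E : Set (ℕ → S)) : Prop :=
  ∀ ω : ℕ → S, ω ∈ E ↔ pathShift^[m] ω ∈ E

/-- A birth-death process: a Markov chain on `ℕ` with positive birth
probabilities `p_i = P(i,i+1)`, positive death probabilities `q_{i+1} = P(i+1,i)`,
all transition probabilities other than `p_i`, `q_i` and `r_i = P(i,i)` zero,
and at least one positive self-transition probability. -/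
structure MarkovChain.IsBirthDeath (X : MarkovChain ℕ) : Prop where
  birth_pos : ∀ i : ℕ, 0 < X.P i (i + 1)
  death_pos : ∀ i : ℕ, 0 < X.P (i + 1) i
  tridiagonal : ∀ i j : ℕ, 1 < |(i : ℤ) - (j : ℤ)| → X.P i j = 0
  self_pos : ∃ i : ℕ, 0 < X.P i i

namespace BirthDeath

/-! ### Cylinder sets in path space -/

/-- Paths agreeing with `s` up to time `n`. -/
def cyl (n : ℕ) (s : ℕ → ℕ) : Set (ℕ → ℕ) := {ω | ∀ k ≤ n, ω k = s k}

/-- The path seen from time `n` on. -/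
def tail (n : ℕ) (ω : ℕ → ℕ) : ℕ → ℕ := fun k => ω (n + k)

lemma measurable_tail (n : ℕ) : Measurable (tail n) :=
  measurable_pi_lambda _ fun k => measurable_pi_apply (n + k)

lemma measurableSet_coord (k : ℕ) (A : Set ℕ) : MeasurableSet {ω : ℕ → ℕ | ω k ∈ A} :=
  measurable_pi_apply k (MeasurableSet.of_discrete (s := A))

lemma measurableSet_cyl (n : ℕ) (s : ℕ → ℕ) : MeasurableSet (cyl n s) := by
  have : cyl n s = ⋂ k, ⋂ (_ : k ≤ n), {ω | ω k ∈ ({s k} : Set ℕ)} := by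
    ext ω; simp [cyl]
  rw [this]
  exact MeasurableSet.iInter fun k => MeasurableSet.iInter fun _ => measurableSet_coord _ _

lemma isPiSystem_cyl : IsPiSystem {t | ∃ n s, t = cyl n s} := by
  rintro _ ⟨n, s, rfl⟩ _ ⟨k, t, rfl⟩ ⟨ω, hs, ht⟩
  refine ⟨max n k, ω, ?_⟩
  ext η
  simp only [cyl, mem_inter_iff, mem_ofPred_eq] at *
  constructor
  · rintro ⟨h1, h2⟩ i hi
    rcases le_max_iff.1 hi with h | h
    · rw [h1 i h, hs i h]
    · rw [h2 i h, ht i h]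
  · intro h
    exact ⟨fun i hi => by rw [h i (hi.trans (le_max_left _ _)), hs i hi],
      fun i hi => by rw [h i (hi.trans (le_max_right _ _)), ht i hi]⟩

lemma generateFrom_cyl :
    (MeasurableSpace.pi : MeasurableSpace (ℕ → ℕ)) =
      MeasurableSpace.generateFrom {t | ∃ n s, t = cyl n s} := by
  apply le_antisymm
  · refine iSup_le fun k => ?_
    rintro _ ⟨A, -, rfl⟩
    have : (fun ω : ℕ → ℕ => ω k) ⁻¹' A =
        ⋃ a : {a : Fin (k + 1) → ℕ // a (Fin.last k) ∈ A},
          cyl k (fun i => if h : i < k + 1 then a.1 ⟨i, h⟩ else 0) := by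
      ext ω
      simp only [mem_preimage, mem_iUnion, cyl, mem_ofPred_eq]
      constructor
      · intro h
        refine ⟨⟨fun i => ω i, by simpa using h⟩, fun i hi => ?_⟩
        simp [Nat.lt_succ_of_le hi]
      · rintro ⟨⟨a, ha⟩, h⟩
        have := h k le_rfl
        simp only [Nat.lt_succ_self, dite_true] at this
        rw [this]
        exact ha
    rw [this]
    exact MeasurableSet.iUnion fun a => MeasurableSpace.measurableSet_generateFrom ⟨_, _, rfl⟩
  · refine MeasurableSpace.generateFrom_le ?_
    rintro _ ⟨n, s, rfl⟩
    exact measurableSet_cyl n s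

lemma cyl_zero (s : ℕ → ℕ) : cyl 0 s = {ω | ω 0 = s 0} := by
  ext ω; simp [cyl]

lemma iUnion_cyl_zero : ⋃ i : ℕ, cyl 0 (fun _ => i) = univ := by
  ext ω; simp [cyl]

lemma pairwise_disjoint_cyl_zero :
    Pairwise (Function.onFun Disjoint fun i : ℕ => cyl 0 (fun _ => i)) := by
  intro i j hij
  refine Set.disjoint_left.2 fun ω h1 h2 => hij ?_
  simp only [cyl_zero, mem_ofPred_eq] at h1 h2
  rw [← h1, h2]

lemma measure_ext_cyl {μ ν : Measure (ℕ → ℕ)} [IsFiniteMeasure μ]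
    (h : ∀ n s, μ (cyl n s) = ν (cyl n s)) : μ = ν :=
  Measure.ext_of_generateFrom_of_iUnion _ (fun i => cyl 0 (fun _ => i)) generateFrom_cyl
    isPiSystem_cyl iUnion_cyl_zero (fun i => ⟨_, _, rfl⟩) (fun _ => measure_ne_top _ _)
    (by rintro _ ⟨n, s, rfl⟩; exact h n s)

lemma ae_eq_zero_of_setIntegral_cyl {μ : Measure (ℕ → ℕ)} [IsFiniteMeasure μ]
    {g : (ℕ → ℕ) → ℝ} (hg : Integrable g μ) (h : ∀ n s, ∫ ω in cyl n s, g ω ∂μ = 0) :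
    g =ᵐ[μ] 0 := by
  have huniv : ∫ ω, g ω ∂μ = 0 := by
    rw [← setIntegral_univ, ← iUnion_cyl_zero,
      integral_iUnion (fun i => measurableSet_cyl _ _) pairwise_disjoint_cyl_zero
        hg.integrableOn]
    simp [h]
  have key : ∀ t, MeasurableSet t → ∫ ω in t, g ω ∂μ = 0 := by
    intro t ht
    induction t, ht using MeasurableSpace.induction_on_inter generateFrom_cyl isPiSystem_cyl with
    | empty => simp
    | basic t ht => obtain ⟨n, s, rfl⟩ := ht; exact h n s
    | compl t ht ih =>
      have := integral_add_compl ht hg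
      rw [ih, huniv, zero_add] at this
      exact this
    | iUnion f hd hf ih =>
      rw [integral_iUnion hf hd hg.integrableOn]
      simp [ih]
  exact hg.ae_eq_zero_of_forall_setIntegral_eq_zero fun t ht _ => key t ht

/-! ### Path laws and the Markov property -/

/-- `μ` gives cylinders the mass prescribed by the transition matrix `P` and the initial
weights `init`. -/
def IsPathLaw (P : ℕ → ℕ → ℝ) (init : ℕ → ℝ) (μ : Measure (ℕ → ℕ)) : Prop :=
  ∀ (n : ℕ) (s : ℕ → ℕ),
    μ (cyl n s) = ENNReal.ofReal (init (s 0) * ∏ k ∈ Finset.range n, P (s k) (s (k + 1)))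

lemma cyl_inter_tail {n : ℕ} {a s : ℕ → ℕ} (k : ℕ) (h : s 0 = a n) :
    cyl n a ∩ tail n ⁻¹' cyl k s = cyl (n + k) (fun i => if i ≤ n then a i else s (i - n)) := by
  ext ω
  simp only [cyl, tail, mem_inter_iff, mem_preimage, mem_ofPred_eq]
  constructor
  · rintro ⟨h1, h2⟩ i hi
    split_ifs with hin
    · exact h1 i hin
    · have := h2 (i - n) (by omega)
      rwa [show n + (i - n) = i by omega] at this
  · intro h1
    refine ⟨fun i hi => by simpa [hi] using h1 i (by omega), fun i hi => ?_⟩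
    have := h1 (n + i) (by omega)
    rw [this]
    split_ifs with hin
    · obtain rfl : i = 0 := by omega
      simpa using h.symm
    · congr 1; omega

lemma cyl_inter_tail_of_ne {n : ℕ} {a s : ℕ → ℕ} (k : ℕ) (h : s 0 ≠ a n) :
    cyl n a ∩ tail n ⁻¹' cyl k s = ∅ := by
  ext ω
  simp only [cyl, tail, mem_inter_iff, mem_preimage, mem_ofPred_eq, mem_empty_iff_false,
    iff_false, not_and]
  intro h1 h2
  have e1 := h1 n le_rfl
  have e2 := h2 0 (Nat.zero_le _)
  exact h (by rw [← e1, ← e2]; rfl)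

lemma IsPathLaw.measure_cyl_inter {P : ℕ → ℕ → ℝ} (hP : ∀ i j, 0 ≤ P i j) {init : ℕ → ℝ}
    {μ : Measure (ℕ → ℕ)} (hμ : IsPathLaw P init μ) {n : ℕ} {a s : ℕ → ℕ} (k : ℕ)
    (h : s 0 = a n) :
    μ (cyl n a ∩ tail n ⁻¹' cyl k s) =
      μ (cyl n a) * ENNReal.ofReal (∏ i ∈ Finset.range k, P (s i) (s (i + 1))) := by
  rw [cyl_inter_tail k h, hμ, hμ, ← ENNReal.ofReal_mul' (Finset.prod_nonneg fun _ _ => hP _ _),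
    Finset.prod_range_add, mul_assoc]
  congr 2
  congr 1
  · refine Finset.prod_congr rfl fun i hi => ?_
    have := Finset.mem_range.1 hi
    rw [if_pos (by omega), if_pos (by omega)]
  · refine Finset.prod_congr rfl fun i _ => ?_
    rw [if_neg (show ¬ n + i + 1 ≤ n by omega), show n + i + 1 - n = i + 1 by omega]
    split_ifs with hin
    · obtain rfl : i = 0 := by omega
      simp [h]
    · rw [show n + i - n = i by omega]

/-- `ν x` is a law of the chain `X` started in `x`. -/
structure IsStartFamily (X : MarkovChain ℕ) (ν : ℕ → Measure (ℕ → ℕ)) : Prop where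
  prob : ∀ x, IsProbabilityMeasure (ν x)
  law : ∀ x, IsPathLaw X.P (fun y => if y = x then 1 else 0) (ν x)

lemma exists_cyl_pos (X : MarkovChain ℕ) (hbd : X.IsBirthDeath) (x : ℕ) :
    ∃ n a, a n = x ∧ X.μ (cyl n a) ≠ 0 := by
  have hlaw : IsPathLaw X.P X.init X.μ := X.μ_cylinder
  obtain ⟨i, hi⟩ : ∃ i, 0 < X.init i := by
    by_contra! h
    have h0 : X.init = fun _ => 0 := funext fun i => le_antisymm (h i) (X.init_nonneg i)
    have := X.init_hasSum
    rw [h0] at this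
    exact zero_ne_one (hasSum_zero.unique this)
  have step : ∀ x y, 0 < X.P x y → (∃ n a, a n = x ∧ X.μ (cyl n a) ≠ 0) →
      ∃ n a, a n = y ∧ X.μ (cyl n a) ≠ 0 := by
    rintro x y hxy ⟨n, a, rfl, h⟩
    refine ⟨n + 1, fun i => if i ≤ n then a i else (fun j => if j = 0 then a n else y) (i - n),
      by simp, ?_⟩
    rw [← cyl_inter_tail (s := fun j => if j = 0 then a n else y) 1 (by simp), hlaw.measure_cyl_inter X.P_nonneg 1 (by simp)]
    refine mul_ne_zero h ?_
    simpa using hxy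
  have hstart : ∃ n a, a n = i ∧ X.μ (cyl n a) ≠ 0 :=
    ⟨0, fun _ => i, rfl, by simpa [hlaw 0] using hi⟩
  have hzero : ∀ j, (∃ n a, a n = j ∧ X.μ (cyl n a) ≠ 0) → ∃ n a, a n = 0 ∧ X.μ (cyl n a) ≠ 0 := by
    intro j
    induction j with
    | zero => exact id
    | succ j ih => exact fun h => ih (step _ _ (hbd.death_pos j) h)
  induction x with
  | zero => exact hzero i hstart
  | succ x ih => exact step _ _ (hbd.birth_pos x) ih

lemma exists_isStartFamily (X : MarkovChain ℕ) (hbd : X.IsBirthDeath) :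
    ∃ ν, IsStartFamily X ν := by
  have := X.μ_prob
  have hlaw : IsPathLaw X.P X.init X.μ := X.μ_cylinder
  choose n a ha hpos using exists_cyl_pos X hbd
  refine ⟨fun x => (X.μ (cyl (n x) (a x)))⁻¹ •
    (X.μ.restrict (cyl (n x) (a x))).map (tail (n x)), fun x => ⟨?_⟩, fun x k s => ?_⟩
  · rw [Measure.smul_apply, Measure.map_apply (measurable_tail _) MeasurableSet.univ]
    simp [ENNReal.inv_mul_cancel (hpos x) (measure_ne_top _ _)]
  · rw [Measure.smul_apply, Measure.map_apply (measurable_tail _) (measurableSet_cyl _ _),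
      Measure.restrict_apply (measurable_tail _ (measurableSet_cyl _ _)), inter_comm, smul_eq_mul]
    by_cases h : s 0 = x
    · rw [hlaw.measure_cyl_inter X.P_nonneg k (by rw [h, ha]), ← mul_assoc,
        ENNReal.inv_mul_cancel (hpos x) (measure_ne_top _ _)]
      simp [h]
    · rw [cyl_inter_tail_of_ne k (by rwa [ha])]
      simp [h]

section Family

variable {X : MarkovChain ℕ} {ν : ℕ → Measure (ℕ → ℕ)}

lemma IsStartFamily.markov (hν : IsStartFamily X ν) {init : ℕ → ℝ} {μ : Measure (ℕ → ℕ)}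
    [IsFiniteMeasure μ] (hμ : IsPathLaw X.P init μ) (n : ℕ) (a : ℕ → ℕ) {E : Set (ℕ → ℕ)}
    (hE : MeasurableSet E) :
    μ (cyl n a ∩ tail n ⁻¹' E) = μ (cyl n a) * ν (a n) E := by
  have key : (μ.restrict (cyl n a)).map (tail n) = μ (cyl n a) • ν (a n) := by
    refine measure_ext_cyl fun k s => ?_
    rw [Measure.smul_apply, Measure.map_apply (measurable_tail _) (measurableSet_cyl _ _),
      Measure.restrict_apply (measurable_tail _ (measurableSet_cyl _ _)), inter_comm, smul_eq_mul,
      hν.law]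
    by_cases h : s 0 = a n
    · rw [hμ.measure_cyl_inter X.P_nonneg k h]
      simp [h]
    · rw [cyl_inter_tail_of_ne k h]
      simp [h]
  rw [← smul_eq_mul, ← Measure.smul_apply, ← key, Measure.map_apply (measurable_tail _) hE,
    Measure.restrict_apply (measurable_tail _ hE), inter_comm]

lemma IsStartFamily.start (hν : IsStartFamily X ν) (x : ℕ) : ∀ᵐ ω ∂ν x, ω 0 = x := by
  have := hν.prob x
  have h : ν x {ω | ω 0 = x} = 1 := by
    have := hν.law x 0 (fun _ => x)
    rw [cyl_zero] at this
    simpa using this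
  have hm : MeasurableSet {ω : ℕ → ℕ | ω 0 = x} := measurableSet_coord 0 {x}
  rw [ae_iff]
  exact (prob_compl_eq_zero_iff hm).2 h

lemma IsStartFamily.step (hν : IsStartFamily X ν) (x : ℕ) {E : Set (ℕ → ℕ)}
    (hE : MeasurableSet E) :
    ν x (tail 1 ⁻¹' E) = ∑' y, ENNReal.ofReal (X.P x y) * ν y E := by
  have := hν.prob x
  let a : ℕ → ℕ → ℕ := fun y i => if i = 0 then x else y
  have h1 : ∀ y, ν x (cyl 1 (a y) ∩ tail 1 ⁻¹' E) = ENNReal.ofReal (X.P x y) * ν y E := by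
    intro y
    rw [hν.markov (hν.law x) 1 (a y) hE, hν.law x]
    simp [a]
  have h2 : ν x (tail 1 ⁻¹' E) = ν x (⋃ y, cyl 1 (a y) ∩ tail 1 ⁻¹' E) := by
    refine measure_congr ?_
    filter_upwards [hν.start x] with ω hω
    refine propext ?_
    change ω ∈ tail 1 ⁻¹' E ↔ ω ∈ ⋃ y, cyl 1 (a y) ∩ tail 1 ⁻¹' E
    rw [← iUnion_inter]
    refine ⟨fun h => ⟨mem_iUnion.2 ⟨ω 1, fun k hk => ?_⟩, h⟩, fun h => h.2⟩
    interval_cases k <;> simp [a, hω]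
  rw [h2, measure_iUnion]
  · simp_rw [h1]
  · intro y z hyz
    refine Set.disjoint_left.2 fun ω h1 h2 => hyz ?_
    have e1 := h1.1 1 le_rfl
    have e2 := h2.1 1 le_rfl
    simp only [a, one_ne_zero, if_false] at e1 e2
    rw [← e1, e2]
  · exact fun y => (measurableSet_cyl _ _).inter (measurable_tail 1 hE)

end Family

/-! ### The averaging operator of a birth-death chain -/

section Averaging

variable {X : MarkovChain ℕ}

/-- The downward transition probability, which is zero in the state `0`. -/
noncomputable def down (X : MarkovChain ℕ) (x : ℕ) : ℝ := if x = 0 then 0 else X.P x (x - 1)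

/-- The action of the transition matrix on functions. -/
noncomputable def avg {E : Type*} [AddCommGroup E] [Module ℝ E] (X : MarkovChain ℕ) (v : ℕ → E)
    (x : ℕ) : E :=
  down X x • v (x - 1) + X.P x x • v x + X.P x (x + 1) • v (x + 1)

lemma down_nonneg (X : MarkovChain ℕ) (x : ℕ) : 0 ≤ down X x := by
  unfold down
  split_ifs
  · exact le_rfl
  · exact X.P_nonneg _ _

lemma tsum_tridiagonal (hbd : X.IsBirthDeath) (x : ℕ) (F : ℕ → ENNReal) :
    ∑' y, ENNReal.ofReal (X.P x y) * F y =
      ENNReal.ofReal (down X x) * F (x - 1) + ENNReal.ofReal (X.P x x) * F x +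
        ENNReal.ofReal (X.P x (x + 1)) * F (x + 1) := by
  cases x with
  | zero =>
    rw [tsum_eq_sum (s := {0, 1})]
    · simp [down]
    · intro y hy
      rw [hbd.tridiagonal 0 y, ENNReal.ofReal_zero, zero_mul]
      simp only [Finset.mem_insert, Finset.mem_singleton, not_or] at hy
      rw [lt_abs]; right; omega
  | succ x =>
    rw [tsum_eq_sum (s := {x, x + 1, x + 1 + 1})]
    · rw [Finset.sum_insert (by simp; omega), Finset.sum_insert (by simp), Finset.sum_singleton]
      simp [down, add_assoc]
    · intro y hy
      rw [hbd.tridiagonal (x + 1) y, ENNReal.ofReal_zero, zero_mul]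
      simp only [Finset.mem_insert, Finset.mem_singleton, not_or] at hy
      rw [lt_abs]
      rcases lt_or_ge y (x + 1) with h | h
      · left; push_cast; omega
      · right; push_cast; omega

lemma IsStartFamily.real_step {ν : ℕ → Measure (ℕ → ℕ)} (hν : IsStartFamily X ν)
    (hbd : X.IsBirthDeath) (x : ℕ) {E : Set (ℕ → ℕ)} (hE : MeasurableSet E) :
    (ν x).real (tail 1 ⁻¹' E) = avg X (fun y => (ν y).real E) x := by
  have := hν.prob
  have h : ∀ (a : ℝ) (y : ℕ), ENNReal.ofReal a * ν y E ≠ ⊤ := fun a y =>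
    ENNReal.mul_ne_top ENNReal.ofReal_ne_top (measure_ne_top _ _)
  rw [Measure.real, hν.step x hE, tsum_tridiagonal hbd, ENNReal.toReal_add (by simp [h]) (h _ _),
    ENNReal.toReal_add (h _ _) (h _ _)]
  simp [avg, Measure.real, X.P_nonneg, down_nonneg]

lemma row_sum (hbd : X.IsBirthDeath) (x : ℕ) : down X x + X.P x x + X.P x (x + 1) = 1 := by
  obtain ⟨ν, hν⟩ := exists_isStartFamily X hbd
  have := hν.prob
  have h := hν.real_step hbd x MeasurableSet.univ
  simp [avg] at h
  exact h.symm

/-- An eigenfunction of a birth-death chain is determined by its value in `0`. -/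
lemma eq_zero_of_avg_eq (hbd : X.IsBirthDeath) {v : ℕ → ℂ} {z : ℂ}
    (hv : ∀ x, avg X v x = z * v x) (h0 : v 0 = 0) (x : ℕ) : v x = 0 := by
  have key : ∀ x, v (x - 1) = 0 ∧ v x = 0 := by
    intro x
    induction x with
    | zero => exact ⟨h0, h0⟩
    | succ x ih =>
      refine ⟨ih.2, ?_⟩
      have h := hv x
      simp only [avg, ih.1, ih.2, smul_zero, mul_zero, zero_add] at h
      exact (smul_eq_zero.1 h).resolve_left (hbd.birth_pos x).ne'
  exact (key x).2

lemma eq_const_of_avg_eq (hbd : X.IsBirthDeath) {u : ℕ → ℝ} (hu : ∀ x, avg X u x = u x)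
    (x : ℕ) : u x = u 0 := by
  have h := eq_zero_of_avg_eq hbd (v := fun x => ((u x - u 0 : ℝ) : ℂ)) (z := 1) (fun x => ?_)
    (by simp) x
  · exact sub_eq_zero.1 (Complex.ofReal_eq_zero.1 h)
  · have h1 := hu x
    have h2 := row_sum hbd x
    simp only [avg, smul_eq_mul, Complex.real_smul] at *
    norm_cast
    linear_combination h1 - u 0 * h2

variable {pi : ℕ → ℝ}

lemma weight_pos (hbd : X.IsBirthDeath) (hpi0 : pi 0 = 1)
    (hpi : ∀ n : ℕ, pi (n + 1) = pi n * X.P n (n + 1) / X.P (n + 1) n) (n : ℕ) : 0 < pi n := by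
  induction n with
  | zero => simp [hpi0]
  | succ n ih => rw [hpi]; exact div_pos (mul_pos ih (hbd.birth_pos n)) (hbd.death_pos n)

lemma weight_balance (hbd : X.IsBirthDeath)
    (hpi : ∀ n : ℕ, pi (n + 1) = pi n * X.P n (n + 1) / X.P (n + 1) n) (n : ℕ) :
    pi (n + 1) * down X (n + 1) = pi n * X.P n (n + 1) := by
  rw [hpi]
  simp [down, div_mul_cancel₀ _ (hbd.death_pos n).ne']

/-- Eigenfunctions for unimodular eigenvalues grow at least as fast as the weighted sums of the
holding probabilities. -/
lemma norm_growth (hbd : X.IsBirthDeath) (hpi0 : pi 0 = 1)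
    (hpi : ∀ n : ℕ, pi (n + 1) = pi n * X.P n (n + 1) / X.P (n + 1) n)
    {v : ℕ → ℂ} {z : ℂ} (hz : ‖z‖ = 1) (hv : ∀ x, avg X v x = z * v x) (n : ℕ) :
    (1 - z.re) * ∑ k ∈ Finset.range (n + 1), X.P k k * pi k * ‖v k‖ ≤
      X.P n (n + 1) * pi n * (‖v (n + 1)‖ - ‖v n‖) := by
  have loc : ∀ n, down X n * (‖v n‖ - ‖v (n - 1)‖) + (1 - z.re) * (X.P n n * ‖v n‖) ≤
      X.P n (n + 1) * (‖v (n + 1)‖ - ‖v n‖) := by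
    intro n
    have h1 : (z - X.P n n) * v n = down X n * v (n - 1) + X.P n (n + 1) * v (n + 1) := by
      have := hv n
      simp only [avg, Complex.real_smul] at this
      linear_combination -this
    have h2 : 1 - X.P n n * z.re ≤ ‖z - X.P n n‖ := by
      have e : ‖z - X.P n n‖ = ‖1 - X.P n n * (starRingEnd ℂ) z‖ := by
        have hzz : z * (starRingEnd ℂ) z = 1 := by
          rw [Complex.mul_conj, Complex.normSq_eq_norm_sq, hz]; norm_num
        rw [← hzz, ← sub_mul, norm_mul, RCLike.norm_conj, hz, mul_one]
      rw [e]
      refine le_trans (le_of_eq ?_) (Complex.re_le_norm _)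
      simp
    have h3 : ‖z - X.P n n‖ * ‖v n‖ ≤
        down X n * ‖v (n - 1)‖ + X.P n (n + 1) * ‖v (n + 1)‖ := by
      rw [← norm_mul, h1]
      refine (norm_add_le _ _).trans (le_of_eq ?_)
      simp [abs_of_nonneg, X.P_nonneg, down_nonneg]
    have h4 := mul_le_mul_of_nonneg_right h2 (norm_nonneg (v n))
    have h5 := row_sum hbd n
    have h6 : (down X n + X.P n n + X.P n (n + 1)) * ‖v n‖ = ‖v n‖ := by rw [h5, one_mul]
    linarith
  induction n with
  | zero =>
    have := loc 0
    simp only [hpi0, zero_add, Finset.sum_range_one, mul_one]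
    simpa [down] using this
  | succ n ih =>
    rw [Finset.sum_range_succ]
    have hp := weight_pos hbd hpi0 hpi (n + 1)
    have h1 := mul_le_mul_of_nonneg_left (loc (n + 1)) hp.le
    have h2 := weight_balance hbd hpi n
    rw [Nat.add_sub_cancel] at h1
    have h3 : pi (n + 1) * (down X (n + 1) * (‖v (n + 1)‖ - ‖v n‖)) =
        X.P n (n + 1) * pi n * (‖v (n + 1)‖ - ‖v n‖) := by
      rw [← mul_assoc, h2]; ring
    linarith

lemma norm_le_norm_succ (hbd : X.IsBirthDeath) (hpi0 : pi 0 = 1)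
    (hpi : ∀ n : ℕ, pi (n + 1) = pi n * X.P n (n + 1) / X.P (n + 1) n)
    {v : ℕ → ℂ} {z : ℂ} (hz : ‖z‖ = 1) (hv : ∀ x, avg X v x = z * v x) :
    Monotone fun n => ‖v n‖ := by
  refine monotone_nat_of_le_succ fun n => ?_
  have h := norm_growth hbd hpi0 hpi hz hv n
  have hc : 0 ≤ 1 - z.re := by linarith [Complex.re_le_norm z]
  have h1 : 0 ≤ (1 - z.re) * ∑ k ∈ Finset.range (n + 1), X.P k k * pi k * ‖v k‖ :=
    mul_nonneg hc (Finset.sum_nonneg fun k _ => mul_nonneg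
      (mul_nonneg (X.P_nonneg _ _) (weight_pos hbd hpi0 hpi k).le) (norm_nonneg _))
  have h2 := mul_pos (hbd.birth_pos n) (weight_pos hbd hpi0 hpi n)
  exact sub_nonneg.1 (nonneg_of_mul_nonneg_right (h1.trans h) h2)

/-- If the series diverges then unimodular eigenvalues other than `1` have no bounded
eigenfunctions. -/
lemma eq_zero_of_bounded (hbd : X.IsBirthDeath) (hpi0 : pi 0 = 1)
    (hpi : ∀ n : ℕ, pi (n + 1) = pi n * X.P n (n + 1) / X.P (n + 1) n)
    (hdiv : Tendsto (fun n : ℕ => ∑ j ∈ Finset.range n,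
        (1 / (X.P j (j + 1) * pi j)) * ∑ k ∈ Finset.range (j + 1), X.P k k * pi k) atTop atTop)
    {v : ℕ → ℂ} {z : ℂ} (hz : ‖z‖ = 1) (hz1 : z ≠ 1) (hv : ∀ x, avg X v x = z * v x)
    {M : ℝ} (hM : ∀ x, ‖v x‖ ≤ M) (x : ℕ) : v x = 0 := by
  refine eq_zero_of_avg_eq hbd hv ?_ x
  by_contra h0
  have hmono := norm_le_norm_succ hbd hpi0 hpi hz hv
  have hc : 0 < 1 - z.re := by
    refine sub_pos.2 (lt_of_le_of_ne ((Complex.re_le_norm z).trans hz.le) fun hre => hz1 ?_)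
    have h1 := Complex.sq_norm z
    rw [hz, Complex.normSq_apply, hre] at h1
    refine Complex.ext (by simpa using hre) ?_
    simpa using h1
  have hv0 : 0 < ‖v 0‖ := norm_pos_iff.2 h0
  have grow : ∀ n, ‖v 0‖ + (1 - z.re) * ‖v 0‖ * ∑ j ∈ Finset.range n,
      (1 / (X.P j (j + 1) * pi j)) * ∑ k ∈ Finset.range (j + 1), X.P k k * pi k ≤ ‖v n‖ := by
    intro n
    induction n with
    | zero => simp
    | succ n ih =>
      rw [Finset.sum_range_succ]
      have hpp := mul_pos (hbd.birth_pos n) (weight_pos hbd hpi0 hpi n)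
      have h := norm_growth hbd hpi0 hpi hz hv n
      have hs : (∑ k ∈ Finset.range (n + 1), X.P k k * pi k) * ‖v 0‖ ≤
          ∑ k ∈ Finset.range (n + 1), X.P k k * pi k * ‖v k‖ := by
        rw [Finset.sum_mul]
        exact Finset.sum_le_sum fun k _ => mul_le_mul_of_nonneg_left (hmono (Nat.zero_le k))
          (mul_nonneg (X.P_nonneg _ _) (weight_pos hbd hpi0 hpi k).le)
      have h2 := (mul_le_mul_of_nonneg_left hs hc.le).trans h
      rw [mul_comm (X.P n (n + 1) * pi n), ← div_le_iff₀ hpp] at h2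
      have e : (1 - z.re) * ‖v 0‖ * (1 / (X.P n (n + 1) * pi n) *
          ∑ k ∈ Finset.range (n + 1), X.P k k * pi k) =
          (1 - z.re) * ((∑ k ∈ Finset.range (n + 1), X.P k k * pi k) * ‖v 0‖) /
            (X.P n (n + 1) * pi n) := by
        ring
      rw [mul_add, e]
      linarith
  obtain ⟨n, hn⟩ := (hdiv.eventually_gt_atTop (M / ((1 - z.re) * ‖v 0‖))).exists
  rw [div_lt_iff₀ (mul_pos hc hv0)] at hn
  have := (grow n).trans (hM n)
  linarith

/-- If the series diverges then bounded space-time harmonic functions which are periodic in time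
are constant. -/
lemma eq_const_of_periodic (hbd : X.IsBirthDeath) (hpi0 : pi 0 = 1)
    (hpi : ∀ n : ℕ, pi (n + 1) = pi n * X.P n (n + 1) / X.P (n + 1) n)
    (hdiv : Tendsto (fun n : ℕ => ∑ j ∈ Finset.range n,
        (1 / (X.P j (j + 1) * pi j)) * ∑ k ∈ Finset.range (j + 1), X.P k k * pi k) atTop atTop)
    {m : ℕ} (hm : 1 ≤ m) {u : ℕ → ℕ → ℝ} (hper : Function.Periodic u m)
    (hu : ∀ n x, u n x = avg X (u (n + 1)) x) (hb : ∀ n x, |u n x| ≤ 1) (n x : ℕ) :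
    u n x = u 0 0 := by
  have : NeZero m := ⟨by omega⟩
  let V : ℕ → ZMod m → ℂ := fun x j => u j.val x
  have hcast : ∀ n : ℕ, u (n : ZMod m).val = u n := fun n => by
    rw [ZMod.val_natCast, hper.map_mod_nat]
  have hsucc : ∀ j : ZMod m, u (j + 1).val = u (j.val + 1) := fun j => by
    rw [← hcast (j.val + 1)]
    simp
  have hV : ∀ k : ZMod m, k ≠ 0 → ∀ x, ZMod.dft (V x) k = 0 := by
    intro k hk
    refine eq_zero_of_bounded hbd hpi0 hpi hdiv (z := ZMod.stdAddChar (-k)) (M := m) ?_ ?_ ?_ ?_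
    · rw [ZMod.stdAddChar_apply, Circle.norm_coe]
    · intro h
      have := ZMod.injective_stdAddChar (h.trans (AddChar.map_zero_eq_one _).symm)
      exact hk (neg_eq_zero.1 this)
    · intro x
      have e : ∀ j : ZMod m, avg X (fun y => V y (j + 1)) x = V x j := by
        intro j
        have := hu j.val x
        simp only [V, hsucc, this]
        simp [avg]
      simp only [ZMod.dft_apply, smul_eq_mul]
      rw [Finset.mul_sum]
      have e2 : avg X (fun y => ∑ j : ZMod m, ZMod.stdAddChar (-(j * k)) * V y j) x =
          ∑ j : ZMod m, ZMod.stdAddChar (-(j * k)) * avg X (fun y => V y j) x := by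
        simp only [avg, Complex.real_smul, Finset.mul_sum, ← Finset.sum_add_distrib]
        exact Finset.sum_congr rfl fun j _ => by ring
      rw [e2, ← Equiv.sum_comp (Equiv.addRight (1 : ZMod m))]
      refine Finset.sum_congr rfl fun j _ => ?_
      rw [Equiv.coe_addRight, e, ← mul_assoc, ← AddChar.map_add_eq_mul]
      congr 2
      ring
    · intro x
      rw [ZMod.dft_apply]
      refine (norm_sum_le _ _).trans ?_
      calc _ ≤ ∑ _j : ZMod m, (1 : ℝ) := Finset.sum_le_sum fun j _ => by
            rw [norm_smul, ZMod.stdAddChar_apply, Circle.norm_coe, one_mul]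
            simpa [V] using hb j.val x
        _ = m := by simp [ZMod.card]
  have hconst : ∀ n x, u n x = u 0 x := by
    intro n x
    have e : ∀ j : ZMod m, V x j = (m : ℂ)⁻¹ • ZMod.dft (V x) 0 := by
      intro j
      conv_lhs => rw [← LinearEquiv.symm_apply_apply ZMod.dft (V x)]
      rw [ZMod.invDFT_apply, Finset.sum_eq_single 0]
      · simp
      · intro k _ hk
        rw [hV k hk x, smul_zero]
      · simp
    have h1 := (e n).trans (e (0 : ℕ)).symm
    simp only [V, hcast] at h1
    exact_mod_cast h1
  rw [hconst]
  refine eq_const_of_avg_eq hbd (fun x => ?_) x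
  rw [hu 0 x]
  congr 1
  exact funext fun y => (hconst _ y).symm

end Averaging

/-! ### Events at multiples of a time step -/

/-- At all late enough times `j` with `m ∣ j + n` the path is in `A`. -/
def lateIn (m : ℕ) (A : Set ℕ) (n : ℕ) : Set (ℕ → ℕ) :=
  {ω | ∃ K, ∀ j, K ≤ j → m ∣ j + n → ω j ∈ A}

lemma measurableSet_lateIn (m : ℕ) (A : Set ℕ) (n : ℕ) : MeasurableSet (lateIn m A n) := by
  have : lateIn m A n = ⋃ K, ⋂ j, ⋂ (_ : K ≤ j), ⋂ (_ : m ∣ j + n), {ω | ω j ∈ A} := by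
    ext ω; simp [lateIn]
  rw [this]
  exact MeasurableSet.iUnion fun K => MeasurableSet.iInter fun j => MeasurableSet.iInter fun _ =>
    MeasurableSet.iInter fun _ => measurableSet_coord j A

lemma tail_preimage_lateIn (m : ℕ) (A : Set ℕ) (n k : ℕ) :
    tail k ⁻¹' lateIn m A (n + k) = lateIn m A n := by
  ext ω
  simp only [lateIn, tail, mem_preimage, mem_ofPred_eq]
  constructor
  · rintro ⟨K, h⟩
    refine ⟨K + k, fun j hj hd => ?_⟩
    have := h (j - k) (by omega) (by rwa [show j - k + (n + k) = j + n by omega])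
    rwa [show k + (j - k) = j by omega] at this
  · rintro ⟨K, h⟩
    exact ⟨K, fun j hj hd => h (k + j) (by omega) (by rwa [show k + j + n = j + (n + k) by ring])⟩

lemma lateIn_periodic (m : ℕ) (A : Set ℕ) : Function.Periodic (lateIn m A) m := by
  intro n
  ext ω
  simp only [lateIn, mem_ofPred_eq]
  refine exists_congr fun K => forall_congr' fun j => imp_congr_right fun _ => ?_
  rw [← add_assoc, Nat.dvd_add_self_right]

lemma L_eq_lateIn (X : MarkovChain ℕ) {m : ℕ} (hm : 1 ≤ m) (A : Set ℕ) :
    X.L m A = lateIn m A 0 := by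
  ext ω
  simp only [MarkovChain.L, lateIn, mem_ofPred_eq, add_zero]
  constructor
  · rintro ⟨K, h⟩
    refine ⟨K * m, ?_⟩
    rintro _ hj ⟨k, rfl⟩
    rw [mul_comm m k] at *
    exact h k (Nat.le_of_mul_le_mul_right hj hm)
  · rintro ⟨K, h⟩
    exact ⟨K, fun k hk => h _ (hk.trans (Nat.le_mul_of_pos_right k hm)) ⟨k, mul_comm _ _⟩⟩

lemma measurableSet_L (X : MarkovChain ℕ) {m : ℕ} (hm : 1 ≤ m) (A : Set ℕ) :
    MeasurableSet (X.L m A) := by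
  rw [L_eq_lateIn X hm]
  exact measurableSet_lateIn _ _ _

lemma L_subset_U (X : MarkovChain ℕ) (m : ℕ) (A : Set ℕ) : X.L m A ⊆ X.U m A := by
  rintro ω ⟨K, h⟩ n
  exact ⟨max n K, le_max_left _ _, h _ (le_max_right _ _)⟩

lemma disjoint_L (X : MarkovChain ℕ) (m : ℕ) {A B : Set ℕ} (h : Disjoint A B) :
    Disjoint (X.L m A) (X.L m B) := by
  refine Set.disjoint_left.2 ?_
  rintro ω ⟨K, hK⟩ ⟨K', hK'⟩
  exact Set.disjoint_left.1 h (hK (max K K') (le_max_left _ _)) (hK' _ (le_max_right _ _))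

lemma L_ne_zero_of_almostClosed {X : MarkovChain ℕ} {m : ℕ} {A : Set ℕ}
    (h : X.AlmostClosed m A) : X.μ (X.L m A) ≠ 0 := by
  rw [← measure_congr (measure_symmDiff_eq_zero_iff.1 h.1)]
  exact h.2

section Hitting

variable {X : MarkovChain ℕ} {ν : ℕ → Measure (ℕ → ℕ)}

/-- The probability of `lateIn m A n` for the chain started in `x`. -/
noncomputable def lateProb (ν : ℕ → Measure (ℕ → ℕ)) (m : ℕ) (A : Set ℕ) (n x : ℕ) : ℝ :=
  (ν x).real (lateIn m A n)

lemma lateProb_periodic (ν : ℕ → Measure (ℕ → ℕ)) (m : ℕ) (A : Set ℕ) :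
    Function.Periodic (lateProb ν m A) m := by
  intro n
  funext x
  rw [lateProb, lateProb, lateIn_periodic m A n]

lemma lateProb_eq_avg (hν : IsStartFamily X ν) (hbd : X.IsBirthDeath) (m : ℕ) (A : Set ℕ)
    (n x : ℕ) : lateProb ν m A n x = avg X (lateProb ν m A (n + 1)) x := by
  rw [lateProb, ← tail_preimage_lateIn m A n 1, hν.real_step hbd x (measurableSet_lateIn _ _ _)]
  rfl

lemma lateProb_nonneg (m : ℕ) (A : Set ℕ) (n x : ℕ) : 0 ≤ lateProb ν m A n x :=
  measureReal_nonneg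

lemma lateProb_le_one (hν : IsStartFamily X ν) (m : ℕ) (A : Set ℕ) (n x : ℕ) :
    lateProb ν m A n x ≤ 1 := by
  have := hν.prob x
  exact measureReal_le_one

lemma abs_lateProb_le_one (hν : IsStartFamily X ν) (m : ℕ) (A : Set ℕ) (n x : ℕ) :
    |lateProb ν m A n x| ≤ 1 := by
  rw [abs_of_nonneg (lateProb_nonneg m A n x)]
  exact lateProb_le_one hν m A n x

lemma real_cyl_inter_L (hν : IsStartFamily X ν) {m : ℕ} (hm : 1 ≤ m) (A : Set ℕ) (n : ℕ)
    (s : ℕ → ℕ) :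
    X.μ.real (cyl n s ∩ X.L m A) = X.μ.real (cyl n s) * lateProb ν m A n (s n) := by
  have := X.μ_prob
  rw [L_eq_lateIn X hm, ← tail_preimage_lateIn m A 0 n, zero_add, Measure.real,
    hν.markov X.μ_cylinder n s (measurableSet_lateIn _ _ _), ENNReal.toReal_mul]
  rfl

/-- A linear relation between the probabilities `lateProb` holds between the indicators. -/
lemma ae_sum_indicator_eq (hν : IsStartFamily X ν) {m : ℕ} (hm : 1 ≤ m) {ι : Type} [Fintype ι]
    (A : ι → Set ℕ) (c : ι → ℝ) (c₀ : ℝ)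
    (h : ∀ n x, ∑ i, c i * lateProb ν m (A i) n x = c₀) :
    ∀ᵐ ω ∂X.μ, ∑ i, c i * (X.L m (A i)).indicator (fun _ => (1 : ℝ)) ω = c₀ := by
  have := X.μ_prob
  have hint : ∀ i, Integrable (fun ω => c i * (X.L m (A i)).indicator (fun _ => (1 : ℝ)) ω) X.μ :=
    fun i => ((integrable_const 1).indicator (measurableSet_L X hm _)).const_mul _
  have hsum : Integrable (fun ω => ∑ i, c i * (X.L m (A i)).indicator (fun _ => (1 : ℝ)) ω) X.μ :=
    integrable_finsetSum _ fun i _ => hint i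
  have key := ae_eq_zero_of_setIntegral_cyl (hsum.sub (integrable_const c₀)) fun n s => ?_
  · filter_upwards [key] with ω hω
    exact sub_eq_zero.1 hω
  · change ∫ ω in cyl n s, ((∑ i, c i * (X.L m (A i)).indicator (fun _ => (1 : ℝ)) ω) - c₀) ∂X.μ = 0
    rw [integral_sub hsum.integrableOn (integrable_const _),
      integral_finsetSum _ fun i _ => (hint i).integrableOn]
    have e : ∀ i, ∫ ω in cyl n s, c i * (X.L m (A i)).indicator (fun _ => (1 : ℝ)) ω ∂X.μ =
        X.μ.real (cyl n s) * (c i * lateProb ν m (A i) n (s n)) := by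
      intro i
      rw [integral_const_mul, setIntegral_indicator (measurableSet_L X hm _), setIntegral_const,
        real_cyl_inter_L hν hm]
      simp only [smul_eq_mul]
      ring
    simp only [e]
    rw [← Finset.mul_sum, h, setIntegral_const, smul_eq_mul, sub_self]

end Hitting

/-! ### The divergent case -/

lemma one_le_beta (X : MarkovChain ℕ) (m : ℕ) : 1 ≤ X.beta m := by
  refine le_sInf ?_
  rintro _ ⟨𝒞, h𝒞, rfl⟩
  rw [one_le_encard_iff_nonempty, nonempty_iff_ne_empty]
  rintro rfl
  have := h𝒞.sum_L_eq_one
  simp at this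

lemma almostClosed_univ (X : MarkovChain ℕ) (m : ℕ) : X.AlmostClosed m univ := by
  have := X.μ_prob
  have hU : X.U m univ = univ := by
    ext ω
    simp only [MarkovChain.U, mem_univ, and_true, mem_ofPred_eq, iff_true]
    exact fun n => ⟨n, le_rfl⟩
  have hL : X.L m univ = univ := by
    ext ω
    simp [MarkovChain.L]
  exact ⟨by simp [MarkovChain.Regular, hU, hL], by simp [MarkovChain.Transient, hU]⟩

lemma beta_eq_one_of_atomic_univ {X : MarkovChain ℕ} {m : ℕ} (h : X.Atomic m univ) :
    X.beta m = 1 := by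
  have := X.μ_prob
  refine le_antisymm (sInf_le ⟨{univ}, ?_, encard_singleton _⟩) (one_le_beta X m)
  have hL : X.L m univ = univ := by
    ext ω
    simp [MarkovChain.L]
  refine ⟨countable_singleton _, ?_, pairwiseDisjoint_singleton _ _, ?_, ?_, ?_, ?_⟩
  · rintro _ rfl; exact h.1
  · rintro _ rfl _ rfl _ _; rfl
  · rintro _ rfl h'; exact absurd h h'
  · rintro _ rfl h'; exact absurd h h'
  · rw [tsum_singleton univ fun C => X.μ (X.L m C), hL, measure_univ]

variable {X : MarkovChain ℕ} {pi : ℕ → ℝ}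

lemma atomic_univ_of_tendsto (hbd : X.IsBirthDeath) (hpi0 : pi 0 = 1)
    (hpi : ∀ n : ℕ, pi (n + 1) = pi n * X.P n (n + 1) / X.P (n + 1) n)
    (hdiv : Tendsto (fun n : ℕ => ∑ j ∈ Finset.range n,
        (1 / (X.P j (j + 1) * pi j)) * ∑ k ∈ Finset.range (j + 1), X.P k k * pi k) atTop atTop)
    {m : ℕ} (hm : 1 ≤ m) : X.Atomic m univ := by
  have := X.μ_prob
  obtain ⟨ν, hν⟩ := exists_isStartFamily X hbd
  refine ⟨almostClosed_univ X m, ?_⟩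
  rintro ⟨A, B, -, -, hAB, hA, hB⟩
  have key : ∀ A, X.AlmostClosed m A → ∀ᵐ ω ∂X.μ, ω ∈ X.L m A := by
    intro A hA
    have h := ae_sum_indicator_eq hν hm (fun _ : Unit => A) (fun _ => 1) (lateProb ν m A 0 0)
      fun n x => by
        simpa using eq_const_of_periodic hbd hpi0 hpi hdiv hm (lateProb_periodic ν m A)
          (lateProb_eq_avg hν hbd m A) (abs_lateProb_le_one hν m A) n x
    simp only [Finset.univ_unique, Finset.sum_singleton, one_mul] at h
    obtain ⟨ω, hω, e⟩ := ((frequently_ae_mem_iff.2 (L_ne_zero_of_almostClosed hA)).and_eventually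
      h).exists
    rw [indicator_of_mem hω] at e
    filter_upwards [h] with η hη
    by_contra hn
    rw [indicator_of_notMem hn, ← e] at hη
    exact zero_ne_one hη
  obtain ⟨ω, h1, h2⟩ := ((key A hA).and (key B hB)).exists
  exact Set.disjoint_left.1 (disjoint_L X m hAB) h1 h2

lemma period_eq_one_of_tendsto (hbd : X.IsBirthDeath) (hpi0 : pi 0 = 1)
    (hpi : ∀ n : ℕ, pi (n + 1) = pi n * X.P n (n + 1) / X.P (n + 1) n)
    (hdiv : Tendsto (fun n : ℕ => ∑ j ∈ Finset.range n,
        (1 / (X.P j (j + 1) * pi j)) * ∑ k ∈ Finset.range (j + 1), X.P k k * pi k) atTop atTop) :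
    X.period = 1 := by
  have hbeta : ∀ m, 1 ≤ m → X.beta m = 1 := fun m hm =>
    beta_eq_one_of_atomic_univ (atomic_univ_of_tendsto hbd hpi0 hpi hdiv hm)
  refine le_antisymm (sSup_le ?_) (le_sSup ⟨1, le_rfl, by simpa using hbeta 1 le_rfl, by simp⟩)
  rintro _ ⟨m, hm, h, rfl⟩
  rw [← h, hbeta m hm]

/-! ### The convergent case -/

/-- The states of parity `i`. -/
def parity (i : ℕ) : Set ℕ := {x | x % 2 = i}

/-- The paths with only finitely many steps that preserve parity. -/
def alternating : Set (ℕ → ℕ) := {ω | ∃ N, ∀ j, N ≤ j → (ω j + ω (j + 1)) % 2 = 1}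

lemma measurableSet_step_parity (n i : ℕ) :
    MeasurableSet {ω : ℕ → ℕ | (ω n + ω (n + 1)) % 2 = i} := by
  have h : Measurable fun ω : ℕ → ℕ => ω n + ω (n + 1) :=
    (measurable_pi_apply n).add (measurable_pi_apply (n + 1))
  exact h (MeasurableSet.of_discrete (s := {x : ℕ | x % 2 = i}))

lemma exists_parity_of_alternating {ω : ℕ → ℕ} (h : ω ∈ alternating) :
    ∃ c < 2, ∃ N, ∀ j, N ≤ j → (ω j + j) % 2 = c := by
  obtain ⟨N, h⟩ := h
  refine ⟨(ω N + N) % 2, Nat.mod_lt _ two_pos, N, fun j hj => ?_⟩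
  induction j, hj using Nat.le_induction with
  | base => rfl
  | succ j hj ih =>
    have := h j hj
    omega

lemma mem_lateIn_parity_iff {ω : ℕ → ℕ} {c N : ℕ} (h : ∀ j, N ≤ j → (ω j + j) % 2 = c)
    (i n : ℕ) : ω ∈ lateIn 2 (parity i) n ↔ (c + n) % 2 = i := by
  constructor
  · rintro ⟨K, hK⟩
    have h1 := hK (2 * (K + N) + n) (by omega) (by omega)
    have h2 := h (2 * (K + N) + n) (by omega)
    simp only [parity, mem_ofPred_eq] at h1
    omega
  · intro hi
    refine ⟨N, fun j hj hd => ?_⟩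
    have h2 := h j hj
    simp only [parity, mem_ofPred_eq]
    omega

section Convergent

variable {ν : ℕ → Measure (ℕ → ℕ)}

lemma sum_real_preserving_le (hν : IsStartFamily X ν) (hbd : X.IsBirthDeath) {f : ℕ → ℝ}
    (hf0 : ∀ x, 0 ≤ f x) (hf : ∀ x, avg X f x = f x - X.P x x) (K x : ℕ) :
    ∑ n ∈ Finset.range K, (ν x).real {ω | (ω n + ω (n + 1)) % 2 = 0} ≤ f x := by
  have := hν.prob
  have hm := fun n => measurableSet_step_parity n 0
  have h0 : ∀ x, (ν x).real {ω | (ω 0 + ω (0 + 1)) % 2 = 0} = X.P x x := by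
    intro x
    have hE : MeasurableSet {ω : ℕ → ℕ | ω 0 ∈ {y | (x + y) % 2 = 0}} := measurableSet_coord 0 _
    have e : (ν x).real {ω | (ω 0 + ω (0 + 1)) % 2 = 0} =
        (ν x).real (tail 1 ⁻¹' {ω : ℕ → ℕ | ω 0 ∈ {y | (x + y) % 2 = 0}}) := by
      refine measureReal_congr ?_
      filter_upwards [hν.start x] with ω hω
      refine propext ?_
      change (ω 0 + ω (0 + 1)) % 2 = 0 ↔ (x + ω (1 + 0)) % 2 = 0
      rw [hω]
    have e2 : ∀ y, (ν y).real {ω : ℕ → ℕ | ω 0 ∈ {y | (x + y) % 2 = 0}} =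
        if (x + y) % 2 = 0 then 1 else 0 := by
      intro y
      split_ifs with h
      · rw [← probReal_univ (μ := ν y)]
        refine measureReal_congr ?_
        filter_upwards [hν.start y] with ω hω
        refine propext ⟨fun _ => trivial, fun _ => ?_⟩
        change (x + ω 0) % 2 = 0
        rwa [hω]
      · rw [← measureReal_empty (μ := ν y)]
        refine measureReal_congr ?_
        filter_upwards [hν.start y] with ω hω
        refine propext ⟨fun h' => ?_, fun h' => h'.elim⟩
        change (x + ω 0) % 2 = 0 at h'
        rw [hω] at h'
        exact (h h').elim
    rw [e, hν.real_step hbd x hE]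
    simp only [avg, e2]
    have a1 : (x + x) % 2 = 0 := by omega
    have a2 : ¬ (x + (x + 1)) % 2 = 0 := by omega
    rw [if_pos a1, if_neg a2]
    cases x with
    | zero => simp [down]
    | succ x => rw [if_neg (by omega)]; simp
  have hs : ∀ n x, (ν x).real {ω | (ω (n + 1) + ω (n + 1 + 1)) % 2 = 0} =
      avg X (fun y => (ν y).real {ω | (ω n + ω (n + 1)) % 2 = 0}) x := by
    intro n x
    rw [← hν.real_step hbd x (hm n)]
    congr 1
    ext ω
    simp only [tail, mem_preimage, mem_ofPred_eq]
    rw [show 1 + n = n + 1 by ring, show 1 + (n + 1) = n + 1 + 1 by ring]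
  induction K generalizing x with
  | zero => simpa using hf0 x
  | succ K ih =>
    rw [Finset.sum_range_succ', h0]
    simp only [hs]
    have e : ∑ n ∈ Finset.range K,
        avg X (fun y => (ν y).real {ω | (ω n + ω (n + 1)) % 2 = 0}) x =
        avg X (fun y => ∑ n ∈ Finset.range K,
          (ν y).real {ω | (ω n + ω (n + 1)) % 2 = 0}) x := by
      simp only [avg, smul_eq_mul, Finset.mul_sum, ← Finset.sum_add_distrib]
    rw [e]
    have h1 := hf x
    have h2 : avg X (fun y => ∑ n ∈ Finset.range K,
        (ν y).real {ω | (ω n + ω (n + 1)) % 2 = 0}) x ≤ avg X f x := by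
      simp only [avg, smul_eq_mul]
      gcongr
      · exact down_nonneg X x
      · exact ih _
      · exact X.P_nonneg _ _
      · exact ih _
      · exact X.P_nonneg _ _
      · exact ih _
    linarith

lemma exists_potential (hbd : X.IsBirthDeath) (hpi0 : pi 0 = 1)
    (hpi : ∀ n : ℕ, pi (n + 1) = pi n * X.P n (n + 1) / X.P (n + 1) n)
    (hconv : ¬ Tendsto (fun n : ℕ => ∑ j ∈ Finset.range n,
        (1 / (X.P j (j + 1) * pi j)) * ∑ k ∈ Finset.range (j + 1), X.P k k * pi k) atTop atTop) :
    ∃ f : ℕ → ℝ, (∀ x, 0 ≤ f x) ∧ ∀ x, avg X f x = f x - X.P x x := by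
  have hmono : Monotone fun n : ℕ => ∑ j ∈ Finset.range n,
      (1 / (X.P j (j + 1) * pi j)) * ∑ k ∈ Finset.range (j + 1), X.P k k * pi k := by
    refine monotone_nat_of_le_succ fun n => ?_
    rw [Finset.sum_range_succ]
    refine le_add_of_nonneg_right (mul_nonneg ?_ (Finset.sum_nonneg fun k _ =>
      mul_nonneg (X.P_nonneg _ _) (weight_pos hbd hpi0 hpi k).le))
    exact one_div_nonneg.2 (mul_pos (hbd.birth_pos n) (weight_pos hbd hpi0 hpi n)).le
  obtain ⟨l, hl⟩ := (tendsto_atTop_of_monotone hmono).resolve_left hconv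
  refine ⟨fun x => l - ∑ j ∈ Finset.range x,
    (1 / (X.P j (j + 1) * pi j)) * ∑ k ∈ Finset.range (j + 1), X.P k k * pi k,
    fun x => sub_nonneg.2 (hmono.ge_of_tendsto hl x), fun x => ?_⟩
  have hp := (hbd.birth_pos x).ne'
  have hw := (weight_pos hbd hpi0 hpi x).ne'
  have hrow := row_sum hbd x
  cases x with
  | zero =>
    simp only [down, if_true, zero_add] at hrow
    simp only [avg, down, hpi0, smul_eq_mul, if_true, Finset.sum_range_one, Finset.range_zero,
      Finset.sum_empty, zero_add, zero_mul, mul_one] at hp ⊢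
    field_simp
    linear_combination l * hrow
  | succ x =>
    have hp' := (hbd.birth_pos x).ne'
    have hw' := (weight_pos hbd hpi0 hpi x).ne'
    have hbal := weight_balance hbd hpi x
    simp only [avg, smul_eq_mul, Nat.add_sub_cancel]
    rw [Finset.sum_range_succ _ (x + 1), Finset.sum_range_succ _ x,
      Finset.sum_range_succ _ (x + 1)]
    generalize ∑ j ∈ Finset.range x,
      (1 / (X.P j (j + 1) * pi j)) * ∑ k ∈ Finset.range (j + 1), X.P k k * pi k = T
    generalize ∑ k ∈ Finset.range (x + 1), X.P k k * pi k = S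
    have h1 : X.P (x + 1) (x + 1 + 1) * (1 / (X.P (x + 1) (x + 1 + 1) * pi (x + 1)) *
        (S + X.P (x + 1) (x + 1) * pi (x + 1))) =
        S / pi (x + 1) + X.P (x + 1) (x + 1) := by
      field_simp
    have h2 : down X (x + 1) * (1 / (X.P x (x + 1) * pi x) * S) = S / pi (x + 1) := by
      rw [mul_comm (X.P x (x + 1)), ← hbal]
      have : down X (x + 1) ≠ 0 := by simpa [down] using (hbd.death_pos x).ne'
      field_simp
    linear_combination (l - T - 1 / (X.P x (x + 1) * pi x) * S) * hrow - h1 + h2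

lemma ae_alternating_start (hν : IsStartFamily X ν) (hbd : X.IsBirthDeath) {f : ℕ → ℝ}
    (hf0 : ∀ x, 0 ≤ f x) (hf : ∀ x, avg X f x = f x - X.P x x) (x : ℕ) :
    ∀ᵐ ω ∂ν x, ω ∈ alternating := by
  have := hν.prob x
  have hsum : ∑' n, ν x {ω | (ω n + ω (n + 1)) % 2 = 0} ≠ ⊤ := by
    refine ne_top_of_le_ne_top (ENNReal.ofReal_ne_top (r := f x))
      (ENNReal.tsum_le_of_sum_range_le fun K => ?_)
    refine le_trans (le_of_eq ?_)
      (ENNReal.ofReal_le_ofReal (sum_real_preserving_le hν hbd hf0 hf K x))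
    rw [ENNReal.ofReal_sum_of_nonneg fun _ _ => measureReal_nonneg]
    exact Finset.sum_congr rfl fun n _ => (ofReal_measureReal (measure_ne_top _ _)).symm
  filter_upwards [ae_eventually_notMem hsum] with ω hω
  obtain ⟨N, hN⟩ := eventually_atTop.1 hω
  refine ⟨N, fun j hj => ?_⟩
  have : ¬ (ω j + ω (j + 1)) % 2 = 0 := hN j hj
  omega

lemma measurableSet_alternating : MeasurableSet alternating := by
  have : alternating = ⋃ N, ⋂ j, ⋂ (_ : N ≤ j), {ω | (ω j + ω (j + 1)) % 2 = 1} := by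
    ext ω; simp [alternating]
  rw [this]
  exact MeasurableSet.iUnion fun K => MeasurableSet.iInter fun j => MeasurableSet.iInter fun _ =>
    measurableSet_step_parity j 1

lemma ae_alternating (hν : IsStartFamily X ν) (h : ∀ x, ∀ᵐ ω ∂ν x, ω ∈ alternating) :
    ∀ᵐ ω ∂X.μ, ω ∈ alternating := by
  have := X.μ_prob
  rw [ae_iff]
  change X.μ alternatingᶜ = 0
  rw [← univ_inter alternatingᶜ, ← iUnion_cyl_zero, iUnion_inter]
  refine measure_iUnion_null fun i => ?_
  have e : tail 0 ⁻¹' alternatingᶜ = alternatingᶜ := by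
    have : tail 0 = id := funext fun ω => funext fun k => congrArg ω (zero_add k)
    rw [this, preimage_id]
  rw [← e, hν.markov X.μ_cylinder 0 _ measurableSet_alternating.compl]
  have := h i
  rw [ae_iff] at this
  exact mul_eq_zero_of_right _ this

/-- A bounded eigenfunction for `-1` does not attain its bound. -/
lemma norm_lt_one_of_eigen (hbd : X.IsBirthDeath) (hpi0 : pi 0 = 1)
    (hpi : ∀ n : ℕ, pi (n + 1) = pi n * X.P n (n + 1) / X.P (n + 1) n)
    {v : ℕ → ℂ} (hv : ∀ x, avg X v x = -1 * v x) (hb : ∀ x, ‖v x‖ ≤ 1) (x : ℕ) :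
    ‖v x‖ < 1 := by
  have hz : ‖(-1 : ℂ)‖ = 1 := by simp
  have hmono := norm_le_norm_succ hbd hpi0 hpi hz hv
  obtain ⟨y, hy⟩ := hbd.self_pos
  by_cases h0 : v 0 = 0
  · rw [eq_zero_of_avg_eq hbd hv h0 x]
    simp
  · have hvy : 0 < ‖v y‖ := (norm_pos_iff.2 h0).trans_le (hmono (Nat.zero_le y))
    have h := norm_growth hbd hpi0 hpi hz hv (max x y)
    have h1 : 0 < ∑ k ∈ Finset.range (max x y + 1), X.P k k * pi k * ‖v k‖ :=
      Finset.sum_pos' (fun k _ => mul_nonneg (mul_nonneg (X.P_nonneg _ _)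
        (weight_pos hbd hpi0 hpi k).le) (norm_nonneg _))
        ⟨y, by simp, mul_pos (mul_pos hy (weight_pos hbd hpi0 hpi y)) hvy⟩
    have h2 : 0 < (1 - (-1 : ℂ).re) := by norm_num
    have h3 := pos_of_mul_pos_right ((mul_pos h2 h1).trans_le h)
      (mul_pos (hbd.birth_pos _) (weight_pos hbd hpi0 hpi _)).le
    have h4 : ‖v x‖ ≤ ‖v (max x y)‖ := hmono (le_max_left _ _)
    linarith [hb (max x y + 1)]

lemma lateProb_parity_pos (hν : IsStartFamily X ν) (hbd : X.IsBirthDeath) (hpi0 : pi 0 = 1)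
    (hpi : ∀ n : ℕ, pi (n + 1) = pi n * X.P n (n + 1) / X.P (n + 1) n)
    (halt : ∀ x, ∀ᵐ ω ∂ν x, ω ∈ alternating) {i : ℕ} (hi : i < 2) (x : ℕ) :
    0 < lateProb ν 2 (parity i) 0 x := by
  have hsum : ∀ y, lateProb ν 2 (parity i) 0 y + lateProb ν 2 (parity i) 1 y = 1 := by
    intro y
    have := hν.prob y
    have e : (ν y).real (lateIn 2 (parity i) 1) = (ν y).real (lateIn 2 (parity i) 0)ᶜ := by
      refine measureReal_congr ?_
      filter_upwards [halt y] with ω hω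
      obtain ⟨c, hc, N, hN⟩ := exists_parity_of_alternating hω
      refine propext ?_
      change ω ∈ lateIn 2 (parity i) 1 ↔ ¬ ω ∈ lateIn 2 (parity i) 0
      rw [mem_lateIn_parity_iff hN, mem_lateIn_parity_iff hN]
      omega
    rw [lateProb, lateProb, e, probReal_compl_eq_one_sub (measurableSet_lateIn _ _ _)]
    ring
  have hlt := norm_lt_one_of_eigen hbd hpi0 hpi
    (v := fun y => ((lateProb ν 2 (parity i) 0 y - lateProb ν 2 (parity i) 1 y : ℝ) : ℂ))
    (fun y => ?_) (fun y => ?_) x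
  · rw [Complex.norm_real, Real.norm_eq_abs, abs_lt] at hlt
    linarith [hsum x]
  · have h0 := lateProb_eq_avg hν hbd 2 (parity i) 0 y
    have h1 := lateProb_eq_avg hν hbd 2 (parity i) 1 y
    have h2 : lateProb ν 2 (parity i) (1 + 1) = lateProb ν 2 (parity i) 0 :=
      lateProb_periodic ν 2 (parity i) 0
    rw [h2] at h1
    simp only [avg, smul_eq_mul, Complex.real_smul, zero_add, neg_one_mul] at *
    norm_cast
    linear_combination h0 - h1
  · rw [Complex.norm_real, Real.norm_eq_abs, abs_le]
    have h0 := lateProb_nonneg (ν := ν) 2 (parity i) 0 y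
    have h1 := lateProb_nonneg (ν := ν) 2 (parity i) 1 y
    constructor <;> linarith [hsum y]

lemma almostClosed_parity (hν : IsStartFamily X ν) (hbd : X.IsBirthDeath) (hpi0 : pi 0 = 1)
    (hpi : ∀ n : ℕ, pi (n + 1) = pi n * X.P n (n + 1) / X.P (n + 1) n)
    (halt : ∀ x, ∀ᵐ ω ∂ν x, ω ∈ alternating) {i : ℕ} (hi : i < 2) :
    X.AlmostClosed 2 (parity i) := by
  have := X.μ_prob
  have hreg : X.U 2 (parity i) =ᵐ[X.μ] X.L 2 (parity i) := by
    filter_upwards [ae_alternating hν halt] with ω hω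
    obtain ⟨c, hc, N, hN⟩ := exists_parity_of_alternating hω
    refine propext ⟨fun h => ?_, fun h => L_subset_U X 2 _ h⟩
    obtain ⟨k, hk, h⟩ := (h : ∀ n, ∃ k, n ≤ k ∧ ω (k * 2) ∈ parity i) N
    change ω ∈ X.L 2 (parity i)
    rw [L_eq_lateIn X one_le_two, mem_lateIn_parity_iff hN]
    have := hN (k * 2) (by omega)
    simp only [parity, mem_ofPred_eq] at h
    omega
  refine ⟨measure_symmDiff_eq_zero_iff.2 hreg, ?_⟩
  rw [MarkovChain.Transient, measure_congr hreg]
  intro h0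
  have hz : ∀ x, X.μ.real (cyl 0 fun _ => x) = 0 := by
    intro x
    have h := real_cyl_inter_L hν one_le_two (parity i) 0 (fun _ => x)
    rw [measureReal_def, measure_mono_null inter_subset_right h0, ENNReal.toReal_zero, eq_comm] at h
    exact (mul_eq_zero.1 h).resolve_right (lateProb_parity_pos hν hbd hpi0 hpi halt hi x).ne'
  have : X.μ univ = 0 := by
    rw [← iUnion_cyl_zero]
    exact measure_iUnion_null fun x => (measureReal_eq_zero_iff (measure_ne_top _ _)).1 (hz x)
  simp at this

lemma atomic_parity (hν : IsStartFamily X ν) (hbd : X.IsBirthDeath) (hpi0 : pi 0 = 1)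
    (hpi : ∀ n : ℕ, pi (n + 1) = pi n * X.P n (n + 1) / X.P (n + 1) n)
    (halt : ∀ x, ∀ᵐ ω ∂ν x, ω ∈ alternating) {i : ℕ} (hi : i < 2) :
    X.Atomic 2 (parity i) := by
  refine ⟨almostClosed_parity hν hbd hpi0 hpi halt hi, ?_⟩
  rintro ⟨A, B, hA, hB, hAB, hA', hB'⟩
  have hpar : Disjoint (parity i) (parity (1 - i)) := by
    refine Set.disjoint_left.2 fun x h1 h2 => ?_
    simp only [parity, mem_ofPred_eq] at h1 h2
    omega
  let C : Fin 3 → Set ℕ := ![A, B, parity (1 - i)]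
  have hC : ∀ k, X.AlmostClosed 2 (C k) := by
    intro k
    fin_cases k
    · exact hA'
    · exact hB'
    · exact almostClosed_parity hν hbd hpi0 hpi halt (by omega)
  have hdisj : ∀ k l, k ≠ l → Disjoint (C k) (C l) := by
    intro k l hkl
    fin_cases k <;> fin_cases l <;> simp [C] at hkl ⊢
    · exact hAB
    · exact hpar.mono_left hA
    · exact hAB.symm
    · exact hpar.mono_left hB
    · exact (hpar.mono_left hA).symm
    · exact (hpar.mono_left hB).symm
  have hdep : ¬ LinearIndependent ℝ
      fun k => ((lateProb ν 2 (C k) 0 0, lateProb ν 2 (C k) 1 0) : ℝ × ℝ) := by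
    intro h
    have := h.fintype_card_le_finrank
    simp at this
  obtain ⟨c, hc, k, hk⟩ := Fintype.not_linearIndependent_iff.1 hdep
  let w : ℕ → ℕ → ℝ := fun n x => ∑ k, c k * lateProb ν 2 (C k) n x
  have hw : ∀ n x, w n x = avg X (w (n + 1)) x := by
    intro n x
    simp only [w, lateProb_eq_avg hν hbd 2 _ n x, avg, smul_eq_mul, Finset.mul_sum,
      ← Finset.sum_add_distrib]
    exact Finset.sum_congr rfl fun _ _ => by ring
  have hper : Function.Periodic w 2 := by
    intro n
    funext x
    simp only [w]
    exact Finset.sum_congr rfl fun l _ => by rw [lateProb_periodic ν 2 (C l) n]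
  have hw0 : w 0 0 = 0 := by
    have := congrArg Prod.fst hc
    simpa [w, Prod.fst_sum] using this
  have hw1 : w 1 0 = 0 := by
    have := congrArg Prod.snd hc
    simpa [w, Prod.snd_sum] using this
  have hstep : ∀ x, w 1 x = avg X (w 0) x := fun x => by
    rw [hw 1 x, ← hper 0]
  have hplus : ∀ x, w 0 x + w 1 x = 0 := by
    intro x
    have := eq_zero_of_avg_eq hbd (v := fun x => ((w 0 x + w 1 x : ℝ) : ℂ)) (z := 1)
      (fun x => ?_) (by simp [hw0, hw1]) x
    · exact_mod_cast this
    · have h0 := hw 0 x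
      have h1 := hstep x
      simp only [avg, smul_eq_mul, Complex.real_smul, zero_add] at *
      norm_cast
      linear_combination -h0 - h1
  have hminus : ∀ x, w 0 x - w 1 x = 0 := by
    intro x
    have := eq_zero_of_avg_eq hbd (v := fun x => ((w 0 x - w 1 x : ℝ) : ℂ)) (z := -1)
      (fun x => ?_) (by simp [hw0, hw1]) x
    · exact_mod_cast this
    · have h0 := hw 0 x
      have h1 := hstep x
      simp only [avg, smul_eq_mul, Complex.real_smul, zero_add, neg_one_mul] at *
      norm_cast
      linear_combination h0 - h1
  have hzero : ∀ n x, w n x = 0 := by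
    intro n x
    rw [← hper.map_mod_nat n]
    rcases Nat.mod_two_eq_zero_or_one n with h | h <;> rw [h] <;> linarith [hplus x, hminus x]
  have hae := ae_sum_indicator_eq hν one_le_two C c 0 hzero
  obtain ⟨ω, hω, e⟩ := ((frequently_ae_mem_iff.2
    (L_ne_zero_of_almostClosed (hC k))).and_eventually hae).exists
  rw [Finset.sum_eq_single k, indicator_of_mem hω, mul_one] at e
  · exact hk e
  · intro l _ hl
    rw [indicator_of_notMem, mul_zero]
    exact Set.disjoint_left.1 (disjoint_L X 2 (hdisj k l hl.symm)) hω
  · simp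

lemma beta_two (hν : IsStartFamily X ν) (hbd : X.IsBirthDeath) (hpi0 : pi 0 = 1)
    (hpi : ∀ n : ℕ, pi (n + 1) = pi n * X.P n (n + 1) / X.P (n + 1) n)
    (halt : ∀ x, ∀ᵐ ω ∂ν x, ω ∈ alternating) : X.beta 2 = 2 := by
  have := X.μ_prob
  have hatom : ∀ i < 2, X.Atomic 2 (parity i) := fun i hi =>
    atomic_parity hν hbd hpi0 hpi halt hi
  have hdisj : Disjoint (parity 0) (parity 1) := by
    refine Set.disjoint_left.2 fun x h1 h2 => ?_
    simp only [parity, mem_ofPred_eq] at h1 h2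
    omega
  have hne : parity 0 ≠ parity 1 := fun h => by
    have h0 : (0 : ℕ) ∈ parity 0 := rfl
    exact Set.disjoint_left.1 hdisj h0 (h ▸ h0)
  apply le_antisymm
  · refine sInf_le ⟨{parity 0, parity 1}, ?_, encard_pair hne⟩
    have hall : ∀ C ∈ ({parity 0, parity 1} : Set (Set ℕ)), X.Atomic 2 C := by
      rintro _ (rfl | rfl)
      · exact hatom 0 two_pos
      · exact hatom 1 one_lt_two
    refine ⟨(Set.toFinite _).countable, fun C hC => (hall C hC).1, ?_,
      fun C hC _ _ h => absurd (hall C hC) h, fun C hC h => absurd (hall C hC) h,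
      fun C hC h => absurd (hall C hC) h, ?_⟩
    · exact pairwise_pair_of_symm.2 fun _ => hdisj
    · have e : ∑' C : ({parity 0, parity 1} : Set (Set ℕ)), X.μ (X.L 2 (C : Set ℕ)) =
          X.μ (X.L 2 (parity 0)) + X.μ (X.L 2 (parity 1)) := by
        have := Finset.tsum_subtype' {parity 0, parity 1} fun C : Set ℕ => X.μ (X.L 2 C)
        rwa [Finset.sum_pair hne, Finset.coe_pair] at this
      rw [e, ← measure_union (disjoint_L X 2 hdisj) (measurableSet_L X one_le_two _),
        ← measure_univ (μ := X.μ)]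
      refine measure_congr ?_
      filter_upwards [ae_alternating hν halt] with ω hω
      obtain ⟨c, hc, N, hN⟩ := exists_parity_of_alternating hω
      refine propext ⟨fun _ => trivial, fun _ => ?_⟩
      change ω ∈ X.L 2 (parity 0) ∪ X.L 2 (parity 1)
      rw [L_eq_lateIn X one_le_two, L_eq_lateIn X one_le_two, mem_union,
        mem_lateIn_parity_iff hN, mem_lateIn_parity_iff hN]
      omega
  · refine le_sInf ?_
    rintro _ ⟨𝒞, h𝒞, rfl⟩
    by_contra! hlt
    have h1 : 𝒞.encard ≤ 1 := Order.le_of_lt_add_one (by rwa [one_add_one_eq_two])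
    rcases encard_le_one_iff_eq.1 h1 with rfl | ⟨C, rfl⟩
    · have := h𝒞.sum_L_eq_one
      simp at this
    · have hLC : X.μ (X.L 2 C) = 1 := by
        have := h𝒞.sum_L_eq_one
        rwa [tsum_singleton C fun C => X.μ (X.L 2 C)] at this
      have haeL : ∀ᵐ ω ∂X.μ, ω ∈ X.L 2 C :=
        (prob_compl_eq_zero_iff (measurableSet_L X one_le_two C)).2 hLC
      have hinter : ∀ i < 2, X.AlmostClosed 2 (C ∩ parity i) := by
        intro i hi
        have hpar := (hatom i hi).1
        have e1 : X.L 2 (C ∩ parity i) =ᵐ[X.μ] X.L 2 (parity i) := by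
          filter_upwards [haeL] with ω hω
          refine propext ⟨?_, ?_⟩
          · rintro ⟨K, h⟩
            exact ⟨K, fun k hk => (h k hk).2⟩
          · rintro ⟨K, h⟩
            obtain ⟨K', h'⟩ := hω
            exact ⟨max K K', fun k hk => ⟨h' k (le_of_max_le_right hk), h k (le_of_max_le_left hk)⟩⟩
        have e2 : X.U 2 (C ∩ parity i) =ᵐ[X.μ] X.L 2 (C ∩ parity i) := by
          filter_upwards [e1, measure_symmDiff_eq_zero_iff.1 hpar.1] with ω h1 h2
          refine propext ⟨fun h => ?_, fun h => L_subset_U X 2 _ h⟩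
          refine h1.symm.mp (h2.mp fun n => ?_)
          obtain ⟨k, hk, hk'⟩ := (h : ∀ n, ∃ k, n ≤ k ∧ ω (k * 2) ∈ C ∩ parity i) n
          exact ⟨k, hk, hk'.2⟩
        refine ⟨measure_symmDiff_eq_zero_iff.2 e2, ?_⟩
        rw [MarkovChain.Transient, measure_congr e2, measure_congr e1]
        exact L_ne_zero_of_almostClosed hpar
      by_cases hat : X.Atomic 2 C
      · exact hat.2 ⟨C ∩ parity 0, C ∩ parity 1, inter_subset_left, inter_subset_left,
          hdisj.mono inter_subset_right inter_subset_right, hinter 0 two_pos, hinter 1 one_lt_two⟩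
      · refine h𝒞.nonatomicNoAtomicSubset C rfl hat (C ∩ parity 0) inter_subset_left
          ⟨hinter 0 two_pos, ?_⟩
        rintro ⟨A, B, hA, hB, h⟩
        exact (hatom 0 two_pos).2
          ⟨A, B, hA.trans inter_subset_right, hB.trans inter_subset_right, h⟩

lemma period_ne_one_of_not_tendsto (hbd : X.IsBirthDeath) (hpi0 : pi 0 = 1)
    (hpi : ∀ n : ℕ, pi (n + 1) = pi n * X.P n (n + 1) / X.P (n + 1) n)
    (hconv : ¬ Tendsto (fun n : ℕ => ∑ j ∈ Finset.range n,
        (1 / (X.P j (j + 1) * pi j)) * ∑ k ∈ Finset.range (j + 1), X.P k k * pi k) atTop atTop) :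
    X.period ≠ 1 := by
  obtain ⟨ν, hν⟩ := exists_isStartFamily X hbd
  obtain ⟨f, hf0, hf⟩ := exists_potential hbd hpi0 hpi hconv
  have hbeta := beta_two hν hbd hpi0 hpi (ae_alternating_start hν hbd hf0 hf)
  have h : 2 ≤ X.period := le_sSup ⟨2, one_le_two, by simpa using hbeta, by simp⟩
  intro h1
  rw [h1] at h
  exact absurd h (by decide)

end Convergent

end BirthDeath

/-- A birth-death process `X` is asymptotically aperiodic if and
only if `Σ_j (1/(p_j π_j)) Σ_{k ≤ j} r_k π_k = ∞`. -/
theorem stmt19 (X : MarkovChain ℕ) (hbd : X.IsBirthDeath)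
    (hirr : X.Irreducible) (hap : X.Aperiodic)
    (pi : ℕ → ℝ) (hpi0 : pi 0 = 1)
    (hpi : ∀ n : ℕ, pi (n + 1) = pi n * X.P n (n + 1) / X.P (n + 1) n) :
    X.period = 1 ↔
      Tendsto (fun n : ℕ => ∑ j ∈ Finset.range n,
        (1 / (X.P j (j + 1) * pi j)) * ∑ k ∈ Finset.range (j + 1), X.P k k * pi k)
        atTop atTop := by
  refine ⟨fun h => ?_, BirthDeath.period_eq_one_of_tendsto hbd hpi0 hpi⟩
  by_contra hconv
  exact BirthDeath.period_ne_one_of_not_tendsto hbd hpi0 hpi hconv h
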